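/- Let 1 < p < q < ∞ and n ≥ 1, and let g be a nonnegative measurable function on (0,∞)×(0,∞) (with second dimension n₂ ≥ 1, exponents coupled by β_i = n_i(1/p - 1/q)). Then the inequality n₁∫₀^∞ n₂∫₀^∞ (n₁∫₀^{s₁} n₂∫₀^{s₂} g(r₁,r₂) r₁^{n₁-1} r₂^{n₂-1} dr₁dr₂)^q s₁^{-n₁q/p' - 1} s₂^{-n₂q/p' - 1} ds₁ds₂ ≤ (A₁A₂)^q (n₁∫₀^∞ n₂∫₀^∞ g(s₁,s₂)^p s₁^{n₁-1} s₂^{n₂-1} ds₁ds₂)^{q/p} holds, where A_i = (p'/q)^{1/q} ((p/(q-p)) B(p/(q-p), pq/(q'(q-p))))^{1/q-1/p} after substituting β_i = n_i(1/p-1/q). -/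

import Mathlib

open MeasureTheory Set
open scoped ENNReal

/-- The Euler Beta function `B(z,w) = ∫₀¹ t^(z-1) (1-t)^(w-1) dt`. -/
noncomputable def betaFn (z w : ℝ) : ℝ :=
  ∫ t in Ioo (0 : ℝ) 1, t ^ (z - 1) * (1 - t) ^ (w - 1)

section

open Filter Topology intervalIntegral

theorem intervalIntegrable_betaIntegrand {z w : ℝ} (hz : 0 < z) (hw : 0 < w) :
    IntervalIntegrable (fun t : ℝ => t ^ (z - 1) * (1 - t) ^ (w - 1)) volume 0 1 := by
  have h := Complex.betaIntegral_convergent (u := z) (v := w) (by simpa) (by simpa)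
  have h2 : IntervalIntegrable (fun t : ℝ => ((t : ℂ) ^ ((z : ℂ) - 1) *
      (1 - (t : ℂ)) ^ ((w : ℂ) - 1)).re) volume 0 1 := by
    rw [intervalIntegrable_iff] at h ⊢
    exact h.re
  refine h2.congr fun t ht => ?_
  rw [uIoc_of_le zero_le_one] at ht
  have h1 : (1 : ℂ) - (t : ℂ) = ((1 - t : ℝ) : ℂ) := by push_cast; rfl
  have hz' : (z : ℂ) - 1 = ((z - 1 : ℝ) : ℂ) := by push_cast; rfl
  have hw' : (w : ℂ) - 1 = ((w - 1 : ℝ) : ℂ) := by push_cast; rfl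
  simp only [h1, hz', hw']
  rw [← Complex.ofReal_cpow ht.1.le, ← Complex.ofReal_cpow (sub_nonneg.2 ht.2),
    ← Complex.ofReal_mul, Complex.ofReal_re]

theorem betaFn_eq_intervalIntegral (z w : ℝ) :
    betaFn z w = ∫ t in (0 : ℝ)..1, t ^ (z - 1) * (1 - t) ^ (w - 1) := by
  rw [integral_of_le zero_le_one, integral_Ioc_eq_integral_Ioo, betaFn]

theorem ofReal_betaFn (z w : ℝ) :
    ((betaFn z w : ℝ) : ℂ) = Complex.betaIntegral z w := by
  rw [betaFn_eq_intervalIntegral, Complex.betaIntegral, ← intervalIntegral.integral_ofReal]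
  refine integral_congr fun t ht => ?_
  rw [uIcc_of_le zero_le_one] at ht
  have h1 : (1 : ℂ) - (t : ℂ) = ((1 - t : ℝ) : ℂ) := by push_cast; rfl
  have hz' : (z : ℂ) - 1 = ((z - 1 : ℝ) : ℂ) := by push_cast; rfl
  have hw' : (w : ℂ) - 1 = ((w - 1 : ℝ) : ℂ) := by push_cast; rfl
  simp only [h1, hz', hw']
  rw [← Complex.ofReal_cpow ht.1, ← Complex.ofReal_cpow (sub_nonneg.2 ht.2),
    ← Complex.ofReal_mul]

theorem betaFn_pos {z w : ℝ} (hz : 0 < z) (hw : 0 < w) : 0 < betaFn z w := by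
  rw [betaFn_eq_intervalIntegral]
  refine intervalIntegral_pos_of_pos_on (intervalIntegrable_betaIntegrand hz hw)
    (fun t ht => ?_) zero_lt_one
  have := ht.1
  have : 0 < 1 - t := sub_pos.2 ht.2
  positivity

theorem betaFn_recurrence {z w : ℝ} (hz : 0 < z) (hw : 0 < w) :
    z * betaFn z (w + 1) = w * betaFn (z + 1) w := by
  have h := Complex.betaIntegral_recurrence (u := z) (v := w) (by simpa) (by simpa)
  have h1 := ofReal_betaFn z (w + 1)
  have h2 := ofReal_betaFn (z + 1) w
  push_cast at h1 h2
  rw [← h1, ← h2] at h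
  exact_mod_cast h

theorem continuousOn_primitive_Icc {h : ℝ → ℝ} {b : ℝ} (hb : 0 ≤ b)
    (hi : IntervalIntegrable h volume 0 b) :
    ContinuousOn (fun w => ∫ u in (0 : ℝ)..w, h u) (Icc 0 b) := by
  have := continuousOn_primitive_interval' hi left_mem_uIcc
  rwa [uIcc_of_le hb] at this

theorem hasDerivAt_primitive_of_continuousOn_Ioo {h : ℝ → ℝ} {b : ℝ}
    (hi : IntervalIntegrable h volume 0 b) (hc : ContinuousOn h (Ioo 0 b))
    {w : ℝ} (hw : w ∈ Ioo 0 b) : HasDerivAt (fun w => ∫ u in (0 : ℝ)..w, h u) (h w) w :=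
  integral_hasDerivAt_right
    (hi.mono_set (by
      rw [uIcc_of_le hw.1.le, uIcc_of_le (hw.1.trans hw.2).le]
      exact Icc_subset_Icc_right hw.2.le))
    (hc.stronglyMeasurableAtFilter isOpen_Ioo w hw) (hc.continuousAt (isOpen_Ioo.mem_nhds hw))

/-- The primitive of a positive density on `(0, 1)` has a continuous inverse that is differentiable
in the interior. -/
theorem exists_inverse_primitive {h : ℝ → ℝ} (hi : IntervalIntegrable h volume 0 1)
    (hc : ContinuousOn h (Ioo 0 1)) (hpos : ∀ u ∈ Ioo (0 : ℝ) 1, 0 < h u) :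
    ∃ W : ℝ → ℝ, ContinuousOn W (Icc 0 (∫ u in (0 : ℝ)..1, h u)) ∧
      W 0 = 0 ∧ W (∫ u in (0 : ℝ)..1, h u) = 1 ∧
      ∀ y ∈ Ioo 0 (∫ u in (0 : ℝ)..1, h u), W y ∈ Ioo (0 : ℝ) 1 ∧
        (∫ u in (0 : ℝ)..(W y), h u) = y ∧ HasDerivAt W (h (W y))⁻¹ y := by
  set H : ℝ → ℝ := fun w => ∫ u in (0 : ℝ)..w, h u with hH
  set M : ℝ := ∫ u in (0 : ℝ)..1, h u with hM
  have hderiv : ∀ w ∈ Ioo (0 : ℝ) 1, HasDerivAt H (h w) w := fun w hw =>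
    hasDerivAt_primitive_of_continuousOn_Ioo hi hc hw
  have hHc : ContinuousOn H (Icc 0 1) := continuousOn_primitive_Icc zero_le_one hi
  have hmono : StrictMonoOn H (Icc 0 1) := by
    refine strictMonoOn_of_deriv_pos (convex_Icc 0 1) hHc fun w hw => ?_
    rw [interior_Icc] at hw
    rw [(hderiv w hw).deriv]
    exact hpos w hw
  have hH0 : H 0 = 0 := by simp [hH]
  have hH1 : H 1 = M := rfl
  have hM0 : 0 < M := by
    rw [← hH0, ← hH1]; exact hmono (by simp) (by simp) zero_lt_one
  have hsurj : SurjOn H (Icc 0 1) (Icc 0 M) := by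
    have := hHc.surjOn_Icc (left_mem_Icc.2 zero_le_one) (right_mem_Icc.2 zero_le_one)
    rwa [hH0, hH1] at this
  set W := Function.invFunOn H (Icc 0 1) with hW
  have hWmem : MapsTo W (Icc 0 M) (Icc 0 1) := hsurj.mapsTo_invFunOn
  have hHW : ∀ y ∈ Icc 0 M, H (W y) = y := hsurj.rightInvOn_invFunOn
  have hWH : ∀ w ∈ Icc (0 : ℝ) 1, W (H w) = w := hmono.injOn.leftInvOn_invFunOn
  have hWmono : StrictMonoOn W (Icc 0 M) := by
    intro x hx y hy hxy
    rw [← hHW x hx, ← hHW y hy] at hxy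
    exact (hmono.lt_iff_lt (hWmem hx) (hWmem hy)).1 hxy
  have hW0 : W 0 = 0 := by simpa [hH0] using hWH 0 (by simp)
  have hW1 : W M = 1 := by simpa [hH1] using hWH 1 (by simp)
  have hWc : ContinuousOn W (Icc 0 M) := by
    refine continuousOn_iff_isClosed.2 fun t ht => ⟨H '' (Icc 0 1 ∩ t), ?_, ?_⟩
    · exact ((isCompact_Icc.inter_right ht).image_of_continuousOn
        (hHc.mono inter_subset_left)).isClosed
    · ext y
      constructor
      · rintro ⟨h1, h2⟩
        exact ⟨⟨W y, ⟨hWmem h2, h1⟩, hHW y h2⟩, h2⟩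
      · rintro ⟨⟨w, ⟨h1, h2⟩, rfl⟩, h3⟩
        exact ⟨by rwa [mem_preimage, hWH w h1], h3⟩
  refine ⟨W, hWc, hW0, hW1, fun y hy => ?_⟩
  have hyI := Ioo_subset_Icc_self hy
  have hmem : W y ∈ Ioo (0 : ℝ) 1 := by
    rw [← hW0, ← hW1]
    exact ⟨hWmono (by simp [hM0.le]) hyI hy.1, hWmono hyI (by simp [hM0.le]) hy.2⟩
  refine ⟨hmem, hHW y hyI, ?_⟩
  refine HasDerivAt.of_local_left_inverse
    (hWc.continuousAt (Icc_mem_nhds hy.1 hy.2)) (hderiv _ hmem) (hpos _ hmem).ne' ?_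
  filter_upwards [Icc_mem_nhds hy.1 hy.2] with z hz using hHW z hz

/-- The arithmetic-geometric mean step in the transport proof of Bliss' inequality. -/
theorem bliss_amgm {p r q k x F w μ : ℝ} (hp : 1 < p) (hr : 0 < r) (hq : q = p * (1 + r))
    (hk : k = (p - 1) / p) (hx : 0 < x) (hF : 0 < F) (hw : 0 < w) (hw1 : w < 1) (hμ : 0 < μ) :
    q * (μ / r) ^ (r / q) * (F ^ q * x ^ (r - q) / w) ≤
      Real.exp ((q - r) * Real.log F - (q - r) * k * Real.log x +
          k * (Real.log (1 - w) - Real.log w)) *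
        ((q - r) * x⁻¹ + μ * (F ^ q * x ^ (r - q)) *
          (w ^ (1 / r) * (1 - w) ^ ((q - 1) / r - 2))⁻¹ / (w * (1 - w))) := by
  have hv : 0 < 1 - w := sub_pos.2 hw1
  generalize 1 - w = v at hv
  have hp0 : 0 < p := by linarith
  have hq0 : 0 < q := by rw [hq]; positivity
  have hqr : 0 < q - r := by rw [hq]; nlinarith
  have hν : 0 < μ / r := div_pos hμ hr
  obtain ⟨ν, hνμ⟩ : ∃ ν, ν = μ / r := ⟨_, rfl⟩
  have hμν : μ = r * ν := by rw [hνμ]; field_simp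
  rw [← hνμ] at hν ⊢
  rw [hμν]
  have key := Real.geom_mean_le_arith_mean2_weighted (w₁ := (q - r) / q) (w₂ := r / q)
    (p₁ := x⁻¹) (p₂ := ν * (F ^ q * x ^ (r - q)) *
          (w ^ (1 / r) * v ^ ((q - 1) / r - 2))⁻¹ / (w * v))
    (by positivity) (by positivity) (by positivity) (by positivity) (by field_simp; ring)
  have hid : Real.exp ((q - r) * Real.log F - (q - r) * k * Real.log x +
          k * (Real.log v - Real.log w)) * (x⁻¹ ^ ((q - r) / q) *
      (ν * (F ^ q * x ^ (r - q)) *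
          (w ^ (1 / r) * v ^ ((q - 1) / r - 2))⁻¹ / (w * v)) ^ (r / q)) =
      ν ^ (r / q) * (F ^ q * x ^ (r - q) / w) := by
    obtain ⟨a, rfl⟩ : ∃ a, Real.exp a = x := ⟨_, Real.exp_log hx⟩
    obtain ⟨b, rfl⟩ : ∃ a, Real.exp a = F := ⟨_, Real.exp_log hF⟩
    obtain ⟨c, rfl⟩ : ∃ a, Real.exp a = w := ⟨_, Real.exp_log hw⟩
    obtain ⟨d, rfl⟩ : ∃ a, Real.exp a = v := ⟨_, Real.exp_log hv⟩
    obtain ⟨e, rfl⟩ : ∃ a, Real.exp a = ν := ⟨_, Real.exp_log hν⟩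
    simp only [Real.log_exp, ← Real.exp_mul, ← Real.exp_add, ← Real.exp_neg, ← Real.exp_sub]
    congr 1
    have : (1 + r) ≠ 0 := by positivity
    subst hk hq
    field_simp
    ring
  calc _ = q * (ν ^ (r / q) * (F ^ q * x ^ (r - q) / w)) := by ring
    _ ≤ _ := by
      rw [← hid]
      refine (mul_le_mul_of_nonneg_left (mul_le_mul_of_nonneg_left key (Real.exp_pos _).le)
        hq0.le).trans_eq ?_
      field_simp

/-- Rewriting of the transport potential in the differentiated factor. -/
theorem bliss_potential_div {p r q k x F w : ℝ} (hp : 1 < p) (hq : q = p * (1 + r))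
    (hk : k = (p - 1) / p) (hx : 0 < x) (hF : 0 < F) (hw : 0 < w) (hw1 : w < 1) :
    Real.exp ((q - r) * Real.log F - (q - r) * k * Real.log x +
          k * (Real.log (1 - w) - Real.log w)) / F =
      (F ^ q * x ^ (r - q) * ((1 - w) / w)) ^ k := by
  have hv : 0 < 1 - w := sub_pos.2 hw1
  generalize 1 - w = v at hv
  obtain ⟨a, rfl⟩ : ∃ a, Real.exp a = x := ⟨_, Real.exp_log hx⟩
  obtain ⟨b, rfl⟩ : ∃ a, Real.exp a = F := ⟨_, Real.exp_log hF⟩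
  obtain ⟨c, rfl⟩ : ∃ a, Real.exp a = w := ⟨_, Real.exp_log hw⟩
  obtain ⟨d, rfl⟩ : ∃ a, Real.exp a = v := ⟨_, Real.exp_log hv⟩
  simp only [Real.log_exp, ← Real.exp_mul, ← Real.exp_add, ← Real.exp_sub]
  congr 1
  have hp0 : p ≠ 0 := by linarith
  subst hk hq
  field_simp
  ring

/-- Young's inequality with a free scale. -/
theorem mul_rpow_le_young {p k a z t : ℝ} (hp : 1 < p) (hk : k = (p - 1) / p)
    (ha : 0 ≤ a) (hz : 0 ≤ z) (ht : 0 < t) :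
    a * z ^ k ≤ t ^ p * a ^ p / p + t ^ (-k⁻¹) * z * k := by
  have hp0 : 0 < p := by linarith
  have hk0 : 0 < k := by rw [hk]; exact div_pos (by linarith) hp0
  have hc : p.HolderConjugate k⁻¹ := by
    rw [Real.holderConjugate_iff]
    refine ⟨hp, ?_⟩
    rw [hk]; field_simp; ring
  have h := Real.young_inequality_of_nonneg (a := t * a) (b := t⁻¹ * z ^ k)
    (by positivity) (by positivity) hc
  rw [Real.mul_rpow ht.le ha, Real.mul_rpow (by positivity) (by positivity),
    ← Real.rpow_mul hz, mul_inv_cancel₀ hk0.ne', Real.rpow_one, Real.inv_rpow ht.le,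
    ← Real.rpow_neg ht.le, div_inv_eq_mul] at h
  calc a * z ^ k = t * a * (t⁻¹ * z ^ k) := by field_simp
    _ ≤ _ := h

/-- Optimising the scale in Young's inequality recovers the product bound. -/
theorem le_rpow_mul_rpow_of_forall_young {p k c E Z : ℝ} (hp : 1 < p) (hk : k = (p - 1) / p)
    (hE : 0 < E) (hZ : 0 < Z)
    (h : ∀ t : ℝ, 0 < t → c ≤ t ^ p * E / p + t ^ (-k⁻¹) * Z * k) :
    c ≤ E ^ (1 / p) * Z ^ k := by
  have hp0 : 0 < p := by linarith
  have hp1 : p - 1 ≠ 0 := by linarith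
  refine (h ((Z / E) ^ (k / p)) (by positivity)).trans_eq ?_
  have e1 : ((Z / E) ^ (k / p)) ^ p * E = E ^ (1 / p) * Z ^ k := by
    obtain ⟨a, rfl⟩ : ∃ a, Real.exp a = Z := ⟨_, Real.exp_log hZ⟩
    obtain ⟨b, rfl⟩ : ∃ a, Real.exp a = E := ⟨_, Real.exp_log hE⟩
    simp only [← Real.exp_mul, ← Real.exp_add, ← Real.exp_sub]
    congr 1
    subst hk
    field_simp
    ring
  have e2 : ((Z / E) ^ (k / p)) ^ (-k⁻¹) * Z = E ^ (1 / p) * Z ^ k := by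
    obtain ⟨a, rfl⟩ : ∃ a, Real.exp a = Z := ⟨_, Real.exp_log hZ⟩
    obtain ⟨b, rfl⟩ : ∃ a, Real.exp a = E := ⟨_, Real.exp_log hE⟩
    simp only [← Real.exp_mul, ← Real.exp_add, ← Real.exp_sub]
    congr 1
    subst hk
    field_simp
    ring
  rw [e1, e2, hk]
  field_simp
  ring

/-- Solving the integrated transport inequality for the left-hand side. -/
theorem bliss_solve {p r q k m M N E : ℝ} (hp : 1 < p) (hr : 0 < r) (hq : q = p * (1 + r))
    (hk : k = (p - 1) / p) (hm : 0 < m) (hM : 0 < M) (hE : 0 < E) (hN : N = q * k * M)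
    (h : q * k * (M / m / r) ^ (r / q) * m ≤ E ^ (1 / p) * (q * k * m) ^ k) :
    m ≤ (q * k)⁻¹ * (1 / r * N) ^ (-r) * E ^ (1 + r) := by
  have hp0 : 0 < p := by linarith
  have hk0 : 0 < k := by rw [hk]; exact div_pos (by linarith) hp0
  have hq0 : 0 < q := by rw [hq]; positivity
  have h2 := Real.rpow_le_rpow (by positivity) h hq0.le
  have hc : 0 < q * k := by positivity
  have hMr : 0 < M / r := by positivity
  have hN' : 1 / r * N = q * k * (M / r) := by rw [hN]; ring
  have hM' : M / m / r = M / r / m := by ring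
  rw [hN']
  rw [hM'] at h2
  generalize q * k = c at h2 hc ⊢
  generalize M / r = M' at h2 hMr ⊢
  have e1 : m = (c * (M' / m) ^ (r / q) * m) ^ q * (c⁻¹ * (c * M') ^ (-r) * ((c * m) ^ k) ^ (-q)) := by
    obtain ⟨a, rfl⟩ : ∃ a, Real.exp a = m := ⟨_, Real.exp_log hm⟩
    obtain ⟨b, rfl⟩ : ∃ a, Real.exp a = c := ⟨_, Real.exp_log hc⟩
    obtain ⟨d, rfl⟩ : ∃ a, Real.exp a = M' := ⟨_, Real.exp_log hMr⟩
    simp only [← Real.exp_mul, ← Real.exp_add, ← Real.exp_sub, ← Real.exp_neg]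
    congr 1
    have : (1 + r) ≠ 0 := by positivity
    subst hk hq
    field_simp
    ring
  have e2 : (E ^ (1 / p) * (c * m) ^ k) ^ q * (c⁻¹ * (c * M') ^ (-r) * ((c * m) ^ k) ^ (-q)) =
      c⁻¹ * (c * M') ^ (-r) * E ^ (1 + r) := by
    obtain ⟨a, rfl⟩ : ∃ a, Real.exp a = m := ⟨_, Real.exp_log hm⟩
    obtain ⟨b, rfl⟩ : ∃ a, Real.exp a = c := ⟨_, Real.exp_log hc⟩
    obtain ⟨d, rfl⟩ : ∃ a, Real.exp a = M' := ⟨_, Real.exp_log hMr⟩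
    obtain ⟨e, rfl⟩ : ∃ a, Real.exp a = E := ⟨_, Real.exp_log hE⟩
    simp only [← Real.exp_mul, ← Real.exp_add, ← Real.exp_neg]
    congr 1
    subst hk hq
    field_simp
    ring
  rw [← e2]
  conv_lhs => rw [e1]
  gcongr

theorem bliss_integrand_intervalIntegrable {q r X L : ℝ} (hr : 0 < r) (hq : 0 < q) (hX : 0 < X)
    {F : ℝ → ℝ} (hFc : Continuous F) (hF0 : ∀ x ∈ Icc 0 X, 0 ≤ F x)
    (hFL : ∀ x ∈ Icc 0 X, F x ≤ L * x) :
    IntervalIntegrable (fun x => F x ^ q * x ^ (r - q)) volume 0 X := by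
  have hL0 : 0 ≤ L := by
    have h := (hF0 X (by simp [hX.le])).trans (hFL X (by simp [hX.le]))
    exact nonneg_of_mul_nonneg_left h hX
  have hbd : IntervalIntegrable (fun x : ℝ => L ^ q * x ^ r) volume 0 X :=
    (intervalIntegrable_rpow' (by linarith)).const_mul _
  refine hbd.mono_fun' ?_ ?_
  · rw [uIoc_of_le hX.le]
    refine ContinuousOn.aestronglyMeasurable (fun x hx => ContinuousAt.continuousWithinAt ?_)
      measurableSet_Ioc
    exact (hFc.continuousAt.rpow_const (Or.inr hq.le)).mul
      (Real.continuousAt_rpow_const _ _ (Or.inl hx.1.ne'))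
  · rw [uIoc_of_le hX.le]
    refine (ae_restrict_iff' measurableSet_Ioc).2 (Eventually.of_forall fun x hx => ?_)
    have hx0 := hx.1
    have h0 := hF0 x ⟨hx.1.le, hx.2⟩
    have h1 := hFL x ⟨hx.1.le, hx.2⟩
    simp only
    rw [Real.norm_of_nonneg (by positivity)]
    calc F x ^ q * x ^ (r - q) ≤ (L * x) ^ q * x ^ (r - q) := by gcongr
      _ = L ^ q * x ^ r := by
        rw [Real.mul_rpow hL0 hx0.le, mul_assoc, ← Real.rpow_add hx0]; congr 2; ring

/-- A lower bound for the transported variable near the origin. -/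
theorem bliss_log_transport_ge {q r X ℓ μ β : ℝ} (hr : 0 < r) (hq : 0 < q)
    (hℓ : 0 < ℓ) (hμ : 0 < μ) {F : ℝ → ℝ} (hFℓ : ∀ x ∈ Icc 0 X, ℓ * x ≤ F x)
    (hJ : IntervalIntegrable (fun x => F x ^ q * x ^ (r - q)) volume 0 X) :
    ∃ c : ℝ, ∀ x ∈ Ioo 0 X, ∀ w ∈ Ioc (0 : ℝ) (1 / 2),
      (∫ u in (0 : ℝ)..w, u ^ (1 / r) * (1 - u) ^ β) =
        μ * ∫ s in (0 : ℝ)..x, F s ^ q * s ^ (r - q) →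
      c + r * Real.log x ≤ Real.log w := by
  set D : ℝ := 1 + (1 / 2) ^ β with hD
  have hD0 : 0 < D := by positivity
  set c₁ : ℝ := μ * (ℓ ^ q / (r + 1)) with hc₁
  have hc₁0 : 0 < c₁ := by positivity
  refine ⟨r / (1 + r) * Real.log (c₁ / D), fun x hx w hw h => ?_⟩
  have hx0 := hx.1
  have hw0 := hw.1
  have hlow : ℓ ^ q / (r + 1) * x ^ (r + 1) ≤ ∫ s in (0 : ℝ)..x, F s ^ q * s ^ (r - q) := by
    have e : ∫ s in (0 : ℝ)..x, ℓ ^ q * s ^ r = ℓ ^ q / (r + 1) * x ^ (r + 1) := by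
      rw [intervalIntegral.integral_const_mul, integral_rpow (Or.inl (by linarith)),
        Real.zero_rpow (by linarith)]
      ring
    rw [← e]
    refine integral_mono_on_of_le_Ioo hx0.le
      ((intervalIntegrable_rpow' (by linarith)).const_mul _)
      (hJ.mono_set ?_) fun s hs => ?_
    · rw [uIcc_of_le hx0.le, uIcc_of_le (hx0.trans hx.2).le]
      exact Icc_subset_Icc_right hx.2.le
    · have hs0 := hs.1
      calc ℓ ^ q * s ^ r = (ℓ * s) ^ q * s ^ (r - q) := by
            rw [Real.mul_rpow hℓ.le hs0.le, mul_assoc, ← Real.rpow_add hs0]; congr 2; ring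
        _ ≤ F s ^ q * s ^ (r - q) := by
          have := hFℓ s ⟨hs0.le, (hs.2.trans hx.2).le⟩
          gcongr
  have hup : (∫ u in (0 : ℝ)..w, u ^ (1 / r) * (1 - u) ^ β) ≤ D * w ^ (1 / r + 1) := by
    refine (Real.le_norm_self _).trans ((intervalIntegral.norm_integral_le_of_norm_le_const
      (C := D * w ^ (1 / r)) fun u hu => ?_).trans_eq ?_)
    · rw [uIoc_of_le hw0.le] at hu
      have hu0 := hu.1
      have hu1 : 1 / 2 ≤ 1 - u := by linarith [hu.2, hw.2]
      have hu1' : 0 < 1 - u := by linarith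
      rw [Real.norm_of_nonneg (by positivity), mul_comm]
      gcongr
      · rcases le_total 0 β with hb | hb
        · exact (Real.rpow_le_one hu1'.le (by linarith) hb).trans
            (by rw [hD]; linarith [Real.rpow_nonneg (by norm_num : (0 : ℝ) ≤ 1 / 2) β])
        · exact (Real.rpow_le_rpow_of_nonpos (by norm_num) hu1 hb).trans (by rw [hD]; linarith)
      · exact hu.2
    · rw [sub_zero, abs_of_pos hw0, Real.rpow_add hw0, Real.rpow_one, mul_assoc]
  have hmain : c₁ * x ^ (r + 1) ≤ D * w ^ (1 / r + 1) := by
    refine le_trans ?_ (h.symm.le.trans hup)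
    rw [hc₁, mul_assoc]
    gcongr
  have hlog := Real.log_le_log (by positivity) hmain
  rw [Real.log_mul hc₁0.ne' (by positivity), Real.log_mul hD0.ne' (by positivity),
    Real.log_rpow hx0, Real.log_rpow hw0] at hlog
  rw [Real.log_div hc₁0.ne' hD0.ne']
  have e : Real.log w = r / (1 + r) * ((1 / r + 1) * Real.log w) := by field_simp
  have e2 : r * Real.log x = r / (1 + r) * ((r + 1) * Real.log x) := by field_simp; ring
  rw [e, e2, ← mul_add]
  exact mul_le_mul_of_nonneg_left (by linarith) (by positivity)

/-- The transport potential vanishes at the origin. -/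
theorem bliss_potential_tendsto_zero {p q r k X L c : ℝ} (hp : 1 < p) (hr : 0 < r)
    (hq : q = p * (1 + r)) (hk : k = (p - 1) / p) (hX : 0 < X) {F w : ℝ → ℝ}
    (hF0 : ∀ x ∈ Ioo 0 X, 0 < F x) (hFL : ∀ x ∈ Icc 0 X, F x ≤ L * x)
    (hw : ∀ x ∈ Ioo 0 X, w x ∈ Ioo (0 : ℝ) 1)
    (hwc : ∀ᶠ x in 𝓝[>] 0, c + r * Real.log x ≤ Real.log (w x)) :
    Tendsto (fun x => Real.exp ((q - r) * Real.log (F x) - (q - r) * k * Real.log x +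
          k * (Real.log (1 - w x) - Real.log (w x)))) (𝓝[>] 0) (𝓝 0) := by
  have hp0 : 0 < p := by linarith
  have hk0 : 0 < k := by rw [hk]; exact div_pos (by linarith) hp0
  have hqr : 0 < q - r := by rw [hq]; nlinarith
  have hlim : Tendsto (fun x : ℝ => Real.exp ((q - r) * Real.log L - k * c) * x) (𝓝[>] 0) (𝓝 0) := by
    have : Tendsto (fun x : ℝ => Real.exp ((q - r) * Real.log L - k * c) * x) (𝓝 0)
        (𝓝 (Real.exp ((q - r) * Real.log L - k * c) * 0)) := by
      exact (continuous_const.mul continuous_id).tendsto 0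
    rw [mul_zero] at this
    exact this.mono_left nhdsWithin_le_nhds
  refine tendsto_of_tendsto_of_tendsto_of_le_of_le' tendsto_const_nhds hlim
    (Eventually.of_forall fun x => (Real.exp_pos _).le) ?_
  filter_upwards [hwc, Ioo_mem_nhdsGT hX] with x hx hxX
  have hx0 := hxX.1
  have hF := hF0 x hxX
  have hL := hFL x ⟨hx0.le, hxX.2.le⟩
  have hLpos : 0 < L := pos_of_mul_pos_left (hF.trans_le hL) hx0.le
  have hlogF := Real.log_le_log hF hL
  rw [Real.log_mul hLpos.ne' hx0.ne'] at hlogF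
  have hlogv : Real.log (1 - w x) ≤ 0 :=
    Real.log_nonpos (sub_nonneg.2 (hw x hxX).2.le) (by linarith [(hw x hxX).1])
  have hexp : Real.exp ((q - r) * Real.log L - k * c) * x =
      Real.exp ((q - r) * Real.log L - k * c + Real.log x) := by
    rw [Real.exp_add, Real.exp_log hx0]
  rw [hexp]
  refine Real.exp_le_exp.2 ?_
  have e1 := mul_le_mul_of_nonneg_left hlogF hqr.le
  have e2 : k * (Real.log (1 - w x) - Real.log (w x)) ≤ k * (0 - (c + r * Real.log x)) := by gcongr
  have e3 : (q - r) * (1 - k) - k * r = 1 := by subst hq hk; field_simp; ring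
  have e4 : (q - r) * Real.log x - (q - r) * k * Real.log x - k * r * Real.log x = Real.log x := by
    calc _ = ((q - r) * (1 - k) - k * r) * Real.log x := by ring
      _ = _ := by rw [e3, one_mul]
  linarith

/-- The differentiated transport inequality. -/
theorem bliss_deriv_le {p r q k x F φ w μ t : ℝ} (hp : 1 < p) (hr : 0 < r) (hq : q = p * (1 + r))
    (hk : k = (p - 1) / p) (hx : 0 < x) (hF : 0 < F) (hφ : 0 < φ) (hw : 0 < w) (hw1 : w < 1)
    (hμ : 0 < μ) (ht : 0 < t) :
    Real.exp ((q - r) * Real.log F - (q - r) * k * Real.log x +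
          k * (Real.log (1 - w) - Real.log w)) *
        ((q - r) * (φ / F) - (q - r) * k * x⁻¹ +
          k * (-(μ * (F ^ q * x ^ (r - q)) *
            (w ^ (1 / r) * (1 - w) ^ ((q - 1) / r - 2))⁻¹) / (1 - w) -
            μ * (F ^ q * x ^ (r - q)) *
            (w ^ (1 / r) * (1 - w) ^ ((q - 1) / r - 2))⁻¹ / w)) ≤
      (q - r) * (t ^ p * φ ^ p / p + t ^ (-k⁻¹) * (F ^ q * x ^ (r - q) * ((1 - w) / w)) * k) -
        k * (q * (μ / r) ^ (r / q) *
          (F ^ q * x ^ (r - q) * ((1 - w) / w) + F ^ q * x ^ (r - q))) := by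
  have hp0 : 0 < p := by linarith
  have hk0 : 0 < k := by rw [hk]; exact div_pos (by linarith) hp0
  have hqr : 0 < q - r := by rw [hq]; nlinarith
  have hv : 0 < 1 - w := sub_pos.2 hw1
  have h1 := mul_le_mul_of_nonneg_left (bliss_amgm hp hr hq hk hx hF hw hw1 hμ) hk0.le
  have h2 := bliss_potential_div (r := r) hp hq hk hx hF hw hw1
  have h3 := mul_le_mul_of_nonneg_left (mul_rpow_le_young hp hk hφ.le
    (z := F ^ q * x ^ (r - q) * ((1 - w) / w)) (by positivity) ht) hqr.le
  rw [← h2] at h3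
  generalize Real.exp _ = P at h1 h3 ⊢
  generalize (w ^ (1 / r) * (1 - w) ^ ((q - 1) / r - 2))⁻¹ = G at h1 ⊢
  have e : F ^ q * x ^ (r - q) * ((1 - w) / w) + F ^ q * x ^ (r - q) =
      F ^ q * x ^ (r - q) / w := by field_simp; ring
  rw [e]
  generalize F ^ q * x ^ (r - q) = j at h1 h3 ⊢
  have e2 : μ * j * G / (w * (1 - w)) = μ * j * G / (1 - w) + μ * j * G / w := by
    field_simp; ring
  rw [e2] at h1
  calc _ = (q - r) * (φ * (P / F)) - k * (P * ((q - r) * x⁻¹ +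
        (μ * j * G / (1 - w) + μ * j * G / w))) := by ring
    _ ≤ _ := by linarith

/-- Bliss' inequality with the sharp constant, for continuous positive functions on a bounded
interval. -/
theorem bliss_continuous {p r q : ℝ} (hp : 1 < p) (hr : 0 < r) (hq : q = p * (1 + r))
    {f : ℝ → ℝ} (hf : Continuous f) (hpos : ∀ x, 0 < f x) {X : ℝ} (hX : 0 < X) :
    IntervalIntegrable (fun x => (∫ s in (0 : ℝ)..x, f s) ^ q * x ^ (r - q)) volume 0 X ∧
    ∫ x in (0 : ℝ)..X, (∫ s in (0 : ℝ)..x, f s) ^ q * x ^ (r - q) ≤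
      (q * ((p - 1) / p))⁻¹ * (1 / r * betaFn (1 / r) ((q - 1) / r)) ^ (-r) *
        (∫ x in (0 : ℝ)..X, f x ^ p) ^ (1 + r) := by
  obtain ⟨k, hk⟩ : ∃ k, k = (p - 1) / p := ⟨_, rfl⟩
  rw [← hk]
  have hp0 : 0 < p := by linarith
  have hk0 : 0 < k := by rw [hk]; exact div_pos (by linarith) hp0
  have hq0 : 0 < q := by rw [hq]; positivity
  have hqr : 0 < q - r := by rw [hq]; nlinarith
  have hqk : q * k + 1 = q - r := by subst hq hk; field_simp; ring
  set F : ℝ → ℝ := fun x => ∫ s in (0 : ℝ)..x, f s with hFdef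
  have hFd : ∀ x, HasDerivAt F (f x) x := fun x => hf.integral_hasStrictDerivAt 0 x |>.hasDerivAt
  have hFc : Continuous F := continuous_iff_continuousAt.2 fun x => (hFd x).continuousAt
  obtain ⟨a, -, ha⟩ := isCompact_Icc.exists_isMinOn (nonempty_Icc.2 hX.le) hf.continuousOn
  obtain ⟨b, -, hb⟩ := isCompact_Icc.exists_isMaxOn (nonempty_Icc.2 hX.le) hf.continuousOn
  have hFL : ∀ x ∈ Icc 0 X, F x ≤ f b * x := fun x hx => by
    have := integral_mono_on (μ := volume) hx.1 (hf.intervalIntegrable 0 x)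
      (continuous_const.intervalIntegrable (μ := volume) 0 x)
      (fun s hs => hb (show s ∈ Icc 0 X from ⟨hs.1, hs.2.trans hx.2⟩))
    simpa [mul_comm] using this
  have hFℓ : ∀ x ∈ Icc 0 X, f a * x ≤ F x := fun x hx => by
    have := integral_mono_on (μ := volume) hx.1
      (continuous_const.intervalIntegrable (μ := volume) 0 x) (hf.intervalIntegrable 0 x)
      (fun s hs => ha (show s ∈ Icc 0 X from ⟨hs.1, hs.2.trans hx.2⟩))
    simpa [mul_comm] using this
  have hF0 : ∀ x ∈ Ioo 0 X, 0 < F x := fun x hx =>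
    (mul_pos (hpos a) hx.1).trans_le (hFℓ x (Ioo_subset_Icc_self hx))
  have hF0' : ∀ x ∈ Icc 0 X, 0 ≤ F x := fun x hx =>
    (mul_nonneg (hpos a).le hx.1).trans (hFℓ x hx)
  set j : ℝ → ℝ := fun x => F x ^ q * x ^ (r - q) with hj
  have hji : IntervalIntegrable j volume 0 X :=
    bliss_integrand_intervalIntegrable hr hq0 hX hFc hF0' hFL
  refine ⟨hji, ?_⟩
  have hjc : ContinuousOn j (Ioo 0 X) := fun x hx => ContinuousAt.continuousWithinAt
    ((hFc.continuousAt.rpow_const (Or.inr hq0.le)).mul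
      (Real.continuousAt_rpow_const _ _ (Or.inl hx.1.ne')))
  have hjpos : ∀ x ∈ Ioo 0 X, 0 < j x := fun x hx => by
    have := hF0 x hx
    have := hx.1
    positivity
  set J : ℝ → ℝ := fun x => ∫ s in (0 : ℝ)..x, j s with hJ
  have hJc : ContinuousOn J (Icc 0 X) := continuousOn_primitive_Icc hX.le hji
  have hJd : ∀ x ∈ Ioo 0 X, HasDerivAt J (j x) x := fun x hx =>
    hasDerivAt_primitive_of_continuousOn_Ioo hji hjc hx
  have hJmono : StrictMonoOn J (Icc 0 X) := by
    refine strictMonoOn_of_deriv_pos (convex_Icc 0 X) hJc fun x hx => ?_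
    rw [interior_Icc] at hx
    rw [(hJd x hx).deriv]
    exact hjpos x hx
  have hJ0 : J 0 = 0 := by simp [hJ]
  set m := J X with hm
  have hm0 : 0 < m := by rw [← hJ0]; exact hJmono (by simp [hX.le]) (by simp [hX.le]) hX
  set Ef : ℝ → ℝ := fun x => ∫ s in (0 : ℝ)..x, f s ^ p with hEf
  have hfpc : Continuous fun s => f s ^ p := hf.rpow_const fun _ => Or.inr hp0.le
  have hEd : ∀ x, HasDerivAt Ef (f x ^ p) x := fun x =>
    (hfpc.integral_hasStrictDerivAt 0 x).hasDerivAt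
  have hE0 : 0 < Ef X := intervalIntegral_pos_of_pos (hfpc.intervalIntegrable 0 X)
    (fun x => Real.rpow_pos_of_pos (hpos x) p) hX
  -- the transport variable
  have hb1 : 0 < (q - 1) / r - 1 := by
    rw [sub_pos, lt_div_iff₀ hr]; nlinarith [mul_pos hq0 hk0]
  set h : ℝ → ℝ := fun u => u ^ (1 / r) * (1 - u) ^ ((q - 1) / r - 2) with hh
  have hhi : IntervalIntegrable h volume 0 1 := by
    have := intervalIntegrable_betaIntegrand (z := 1 / r + 1) (w := (q - 1) / r - 1)
      (by positivity) hb1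
    convert this using 3
    · ring_nf
    · ring_nf
  have hhM : ∫ u in (0 : ℝ)..1, h u = betaFn (1 / r + 1) ((q - 1) / r - 1) := by
    rw [betaFn_eq_intervalIntegral]
    congr 1
    ext u
    simp only [hh]
    congr 2 <;> ring
  obtain ⟨M, hMdef⟩ : ∃ M, M = betaFn (1 / r + 1) ((q - 1) / r - 1) := ⟨_, rfl⟩
  have hM0 : 0 < M := hMdef ▸ betaFn_pos (by positivity) hb1
  have hhpos : ∀ u ∈ Ioo (0 : ℝ) 1, 0 < h u := fun u hu => by
    have := hu.1
    have : 0 < 1 - u := sub_pos.2 hu.2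
    positivity
  have hcont : ∀ α β : ℝ, ContinuousOn (fun u : ℝ => u ^ α * (1 - u) ^ β) (Ioo 0 1) :=
    fun α β u hu => ContinuousAt.continuousWithinAt
      ((Real.continuousAt_rpow_const _ _ (Or.inl hu.1.ne')).mul
        ((continuousAt_const.sub continuousAt_id).rpow_const (Or.inl (sub_pos.2 hu.2).ne')))
  obtain ⟨W, hWc, hW0, hW1, hW⟩ := exists_inverse_primitive hhi (hcont _ _) hhpos
  rw [hhM, ← hMdef] at hWc hW1 hW
  set μ : ℝ := M / m with hμ
  have hμ0 : 0 < μ := div_pos hM0 hm0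
  have hμm : μ * m = M := by rw [hμ]; field_simp
  have hmaps : ∀ x ∈ Icc 0 X, μ * J x ∈ Icc 0 M := fun x hx => by
    have h1 := hJmono.monotoneOn (by simp [hX.le]) hx hx.1
    have h2 := hJmono.monotoneOn hx (by simp [hX.le]) hx.2
    rw [hJ0] at h1
    exact ⟨by positivity, by rw [← hμm]; gcongr⟩
  have hmaps' : ∀ x ∈ Ioo 0 X, μ * J x ∈ Ioo 0 M := fun x hx => by
    have h1 := hJmono (by simp [hX.le]) (Ioo_subset_Icc_self hx) hx.1
    have h2 := hJmono (Ioo_subset_Icc_self hx) (by simp [hX.le]) hx.2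
    rw [hJ0] at h1
    exact ⟨by positivity, by rw [← hμm]; gcongr⟩
  set w : ℝ → ℝ := fun x => W (μ * J x) with hw
  have hwI : ∀ x ∈ Ioo 0 X, w x ∈ Ioo (0 : ℝ) 1 := fun x hx => (hW _ (hmaps' x hx)).1
  have hwd : ∀ x ∈ Ioo 0 X, HasDerivAt w (μ * j x * (h (w x))⁻¹) x := fun x hx => by
    have := (hW _ (hmaps' x hx)).2.2.comp x ((hJd x hx).const_mul μ)
    rw [mul_comm]
    exact this
  have hwc : ContinuousOn w (Icc 0 X) := hWc.comp (hJc.const_mul μ) hmaps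
  have hw0 : w 0 = 0 := by simp [hw, hJ0, hW0]
  have hwX : w X = 1 := by simp only [hw]; rw [← hm, hμm, hW1]
  have hwmaps : ∀ x ∈ Icc 0 X, w x ∈ Icc (0 : ℝ) 1 := fun x hx => by
    rcases eq_or_lt_of_le hx.1 with h1 | h1
    · simp [← h1, hw0]
    rcases eq_or_lt_of_le hx.2 with h2 | h2
    · simp [h2, hwX]
    exact Ioo_subset_Icc_self (hwI x ⟨h1, h2⟩)
  -- the conjugate term
  set η : ℝ → ℝ := fun u => u ^ (1 / r - 1) * (1 - u) ^ ((q - 1) / r - 1) with hη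
  have hb2 : 0 < (q - 1) / r := by linarith
  have hηi : IntervalIntegrable η volume 0 1 :=
    intervalIntegrable_betaIntegrand (by positivity) hb2
  obtain ⟨N, hNdef⟩ : ∃ N, N = betaFn (1 / r) ((q - 1) / r) := ⟨_, rfl⟩
  have hNM : N = q * k * M := by
    have := betaFn_recurrence (z := 1 / r) (w := (q - 1) / r - 1) (by positivity) hb1
    rw [sub_add_cancel, ← hNdef, ← hMdef] at this
    have h3 : q * k = q - 1 - r := by linarith
    rw [h3]
    field_simp at this
    linarith
  set Z : ℝ → ℝ := fun x => μ⁻¹ * ∫ u in (0 : ℝ)..(w x), η u with hZ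
  have hZ0 : Z 0 = 0 := by simp [hZ, hw0]
  have hZX : Z X = q * k * m := by
    simp only [hZ]
    rw [hwX, ← betaFn_eq_intervalIntegral, ← hNdef, hNM, ← hμm]
    field_simp
  have hZc : ContinuousOn Z (Icc 0 X) :=
    ((continuousOn_primitive_Icc zero_le_one hηi).comp hwc hwmaps).const_mul _
  have hZd : ∀ x ∈ Ioo 0 X, HasDerivAt Z (j x * ((1 - w x) / w x)) x := fun x hx => by
    have h1 := ((hasDerivAt_primitive_of_continuousOn_Ioo hηi (hcont _ _) (hwI x hx)).comp x
      (hwd x hx)).const_mul μ⁻¹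
    refine h1.congr_deriv ?_
    have hu := (hwI x hx).1
    have hv : 0 < 1 - w x := sub_pos.2 (hwI x hx).2
    simp only [hη, hh]
    rw [Real.rpow_sub hu, Real.rpow_one, show (q - 1) / r - 1 = ((q - 1) / r - 2) + 1 by ring,
      Real.rpow_add hv, Real.rpow_one]
    field_simp
  -- the potential
  set P : ℝ → ℝ := fun x => Real.exp ((q - r) * Real.log (F x) - (q - r) * k * Real.log x +
          k * (Real.log (1 - w x) - Real.log (w x))) with hP
  have hPlim : Tendsto P (𝓝[>] 0) (𝓝 0) := by
    obtain ⟨c, hc⟩ := bliss_log_transport_ge (β := (q - 1) / r - 2) hr hq0 (hpos a) hμ0 hFℓ hji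
    refine bliss_potential_tendsto_zero (c := c) hp hr hq hk hX hF0 hFL hwI ?_
    have hlim : Tendsto w (𝓝[>] 0) (𝓝 0) := by
      have := (hwc 0 (by simp [hX.le])).mono_left
        (nhdsWithin_le_of_mem (Filter.mem_of_superset (Ioo_mem_nhdsGT hX) Ioo_subset_Icc_self))
      rwa [hw0] at this
    filter_upwards [Ioo_mem_nhdsGT hX, hlim.eventually (gt_mem_nhds (by norm_num : (0 : ℝ) < 1 / 2))]
      with x hx hx2
    exact hc x hx (w x) ⟨(hwI x hx).1, hx2.le⟩ (hW _ (hmaps' x hx)).2.1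
  have hPd : ∀ x ∈ Ioo 0 X, HasDerivAt P (P x *
      ((q - r) * (f x / F x) - (q - r) * k * x⁻¹ +
          k * (-(μ * j x * (h (w x))⁻¹) / (1 - w x) - μ * j x * (h (w x))⁻¹ / w x))) x :=
    fun x hx => by
      have hu := (hwI x hx).1
      have hv : 0 < 1 - w x := sub_pos.2 (hwI x hx).2
      exact (((((hFd x).log (hF0 x hx).ne').const_mul _).sub
        ((Real.hasDerivAt_log hx.1.ne').const_mul _)).add
        (((((hwd x hx).const_sub 1).log hv.ne').sub ((hwd x hx).log hu.ne')).const_mul k)).exp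
  refine bliss_solve hp hr hq hk hm0 hM0 hE0 (hNdef ▸ hNM) ?_
  refine le_rpow_mul_rpow_of_forall_young hp hk hE0 (by positivity) fun t ht => ?_
  set R : ℝ → ℝ := fun x => k * (q * (μ / r) ^ (r / q) * (Z x + J x)) -
    (q - r) * (t ^ p * Ef x / p + t ^ (-k⁻¹) * Z x * k) with hR
  have hRc : ContinuousOn R (Icc 0 X) := by
    have hEc : ContinuousOn Ef (Icc 0 X) := fun x _ => (hEd x).continuousAt.continuousWithinAt
    fun_prop
  have hR0 : R 0 = 0 := by simp [hR, hZ0, hJ0, hEf]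
  have hanti : AntitoneOn (fun x => P x + R x) (Ioo 0 X) := by
    have hd : ∀ x ∈ Ioo 0 X, ∃ D ≤ 0, HasDerivAt (fun x => P x + R x) D x := fun x hx => by
      have hRd := ((((hZd x hx).add (hJd x hx)).const_mul (q * (μ / r) ^ (r / q))).const_mul k).sub
        (((((hEd x).const_mul (t ^ p)).div_const p).add
          (((hZd x hx).const_mul (t ^ (-k⁻¹))).mul_const k)).const_mul (q - r))
      refine ⟨_, ?_, (hPd x hx).add hRd⟩
      have := bliss_deriv_le hp hr hq hk hx.1 (hF0 x hx) (hpos x) (hwI x hx).1 (hwI x hx).2 hμ0 ht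
      simp only [hP, hj, hh]
      linarith
    refine antitoneOn_of_deriv_nonpos (convex_Ioo 0 X)
      (fun x hx => ?_) (fun x hx => ?_) (fun x hx => ?_)
    · obtain ⟨D, -, hD⟩ := hd x hx
      exact hD.continuousAt.continuousWithinAt
    · rw [interior_Ioo] at hx
      obtain ⟨D, -, hD⟩ := hd x hx
      exact hD.differentiableAt.differentiableWithinAt
    · rw [interior_Ioo] at hx
      obtain ⟨D, hD0, hD⟩ := hd x hx
      rwa [hD.deriv]
  have hle : ∀ x ∈ Ioo 0 X, R x ≤ 0 := fun x hx => by
    have hRlim : Tendsto R (𝓝[>] 0) (𝓝 0) := by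
      have := (hRc 0 (by simp [hX.le])).mono_left
        (nhdsWithin_le_of_mem (Filter.mem_of_superset (Ioo_mem_nhdsGT hX) Ioo_subset_Icc_self))
      rwa [hR0] at this
    have hlim := hPlim.add hRlim
    rw [add_zero] at hlim
    refine ge_of_tendsto hlim ?_
    filter_upwards [Ioo_mem_nhdsGT hx.1] with y hy
    have h1 := hanti ⟨hy.1, hy.2.trans hx.2⟩ hx hy.2.le
    have h2 : 0 < P x := Real.exp_pos _
    simp only at h1
    linarith
  have hRX : R X ≤ 0 := by
    have hRlim : Tendsto R (𝓝[<] X) (𝓝 (R X)) :=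
      (hRc X (by simp [hX.le])).mono_left
        (nhdsWithin_le_of_mem (Filter.mem_of_superset (Ioo_mem_nhdsLT hX) Ioo_subset_Icc_self))
    refine le_of_tendsto hRlim ?_
    filter_upwards [Ioo_mem_nhdsLT hX] with y hy using hle y hy
  simp only [hR] at hRX
  rw [hZX, ← hm] at hRX
  have e : k * (q * (μ / r) ^ (r / q) * (q * k * m + m)) =
      (q - r) * (q * k * (μ / r) ^ (r / q) * m) := by
    rw [← hqk]; ring
  rw [e, ← mul_sub] at hRX
  have := nonpos_of_mul_nonpos_right hRX hqr
  linarith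

theorem exists_continuous_pos_eLpNorm_sub_le {p : ℝ≥0∞} (hp : 1 ≤ p) (hp' : p ≠ ∞)
    {μ : Measure ℝ} [IsFiniteMeasure μ] {f : ℝ → ℝ} (hf0 : ∀ x, 0 ≤ f x) (hf : MemLp f p μ)
    {δ : ℝ≥0∞} (hδ : δ ≠ 0) :
    ∃ ψ : ℝ → ℝ, Continuous ψ ∧ (∀ x, 0 < ψ x) ∧ eLpNorm (f - ψ) p μ ≤ δ := by
  have hp0 : p ≠ 0 := (one_pos.trans_le hp).ne'
  obtain ⟨φ, hφ, -⟩ := hf.exists_boundedContinuous_eLpNorm_sub_le hp' (ENNReal.half_pos hδ).ne'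
  obtain ⟨ε, hε, hεδ⟩ := ENNReal.exists_nnreal_pos_mul_lt
    (ENNReal.rpow_ne_top_of_nonneg (y := 1 / p.toReal) (by positivity) (measure_ne_top μ univ))
    (ENNReal.half_pos hδ).ne'
  have hφm := φ.continuous.aestronglyMeasurable (μ := μ)
  refine ⟨fun x => |φ x| + ε, by fun_prop, fun x => by positivity, ?_⟩
  calc eLpNorm (f - fun x => |φ x| + (ε : ℝ)) p μ
      ≤ eLpNorm ((fun x => |(f - φ) x|) + fun _ => (ε : ℝ)) p μ := by
        refine eLpNorm_mono fun x => ?_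
        have h1 : |f x - (|φ x|)| ≤ |f x - φ x| := by
          simpa [abs_of_nonneg (hf0 x)] using abs_abs_sub_abs_le (f x) (φ x)
        have h2 : |f x - (|φ x|) - ε| ≤ |f x - (|φ x|)| + |(ε : ℝ)| := abs_sub _ _
        simp only [Pi.sub_apply, Pi.add_apply, Real.norm_eq_abs]
        rw [abs_of_nonneg (add_nonneg (abs_nonneg _) ε.coe_nonneg), ← sub_sub]
        rw [NNReal.abs_eq] at h2
        linarith
    _ ≤ eLpNorm (fun x => |(f - φ) x|) p μ + eLpNorm (fun _ => (ε : ℝ)) p μ :=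
        eLpNorm_add_le (hf.1.sub hφm).norm aestronglyMeasurable_const hp
    _ ≤ δ / 2 + δ / 2 := by
        gcongr
        · simpa only [← Real.norm_eq_abs, eLpNorm_norm] using hφ
        · rw [eLpNorm_const' _ hp0 hp']
          simpa using hεδ.le
    _ = δ := ENNReal.add_halves δ

/-- A weighted Hardy inequality for continuous positive functions extends to measurable ones. -/
theorem lintegral_hardy_of_continuous {p q c X : ℝ} (hp : 1 < p) (hq : 0 < q) (hc : 0 < c)
    {w : ℝ → ℝ≥0∞} (hw : Measurable w) (hw' : ∀ x, w x ≠ ∞) {K : ℝ≥0∞} (hK0 : K ≠ 0)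
    (hK : K ≠ ∞)
    (h : ∀ φ : ℝ → ℝ, Continuous φ → (∀ x, 0 < φ x) →
      ∫⁻ x in Ioo 0 X, (∫⁻ s in Ioo 0 x, ENNReal.ofReal (φ s)) ^ q * w x ≤
        K * (∫⁻ x in Ioo 0 X, ENNReal.ofReal (φ x) ^ p) ^ c)
    {f : ℝ → ℝ≥0∞} (hf : Measurable f) :
    ∫⁻ x in Ioo 0 X, (∫⁻ s in Ioo 0 x, f s) ^ q * w x ≤ K * (∫⁻ x in Ioo 0 X, f x ^ p) ^ c := by
  have hp0 : 0 < p := by positivity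
  set μ := volume.restrict (Ioo 0 X) with hμ
  by_cases hfin : ∫⁻ x, f x ^ p ∂μ = ∞
  · simp [hfin, ENNReal.top_rpow_of_pos hc, ENNReal.mul_top hK0]
  set P : ℝ≥0∞ := ENNReal.ofReal p with hP
  have hP0 : P ≠ 0 := by simpa [hP] using hp0
  have hPt : P.toReal = p := ENNReal.toReal_ofReal hp0.le
  have hP1 : 1 ≤ P := by simpa [hP] using hp.le
  have hnorm : ∀ φ : ℝ → ℝ, eLpNorm φ P μ = (∫⁻ x, ‖φ x‖ₑ ^ p ∂μ) ^ (1 / p) := fun φ => by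
    rw [eLpNorm_eq_lintegral_rpow_enorm_toReal hP0 ENNReal.ofReal_ne_top, hPt]
  have hae : ∀ᵐ x ∂μ, f x < ∞ := by
    filter_upwards [ae_lt_top (hf.pow_const p) hfin] with x hx
    exact (ENNReal.rpow_lt_top_iff_of_pos hp0).1 hx
  set F : ℝ → ℝ := fun x => (f x).toReal with hF
  have hFf : ∀ᵐ x ∂μ, ‖F x‖ₑ = f x := by
    filter_upwards [hae] with x hx
    rw [hF, Real.enorm_eq_ofReal ENNReal.toReal_nonneg, ENNReal.ofReal_toReal hx.ne]
  have hN : eLpNorm F P μ = (∫⁻ x, f x ^ p ∂μ) ^ (1 / p) := by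
    rw [hnorm]
    congr 1
    exact lintegral_congr_ae (hFf.mono fun x hx => by simp only [hx])
  have hNfin : eLpNorm F P μ ≠ ∞ := hN ▸ ENNReal.rpow_ne_top_of_nonneg (by positivity) hfin
  have hFm : Measurable F := hf.ennreal_toReal
  have hFmem : MemLp F P μ := ⟨hFm.aestronglyMeasurable, hNfin.lt_top⟩
  set δ : ℕ → ℝ≥0∞ := fun n => ((n : ℝ≥0∞))⁻¹ with hδ
  have hδlim : Tendsto δ atTop (𝓝 0) := ENNReal.tendsto_inv_nat_nhds_zero
  choose ψ hψc hψpos hψ using fun n => exists_continuous_pos_eLpNorm_sub_le hP1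
    ENNReal.ofReal_ne_top (fun _ => ENNReal.toReal_nonneg) hFmem (δ := δ n) (by simp [hδ])
  set C : ℝ≥0∞ := μ univ ^ (1 - 1 / p) with hC
  have hCfin : C ≠ ∞ := ENNReal.rpow_ne_top_of_nonneg
    (by rw [sub_nonneg, div_le_one hp0]; exact hp.le) (measure_ne_top _ _)
  have hψm : ∀ n, AEStronglyMeasurable (ψ n) μ := fun n => (hψc n).aestronglyMeasurable
  have hprim : ∀ n, ∀ x ∈ Ioo 0 X,
      ∫⁻ s in Ioo 0 x, f s ≤ (∫⁻ s in Ioo 0 x, ENNReal.ofReal (ψ n s)) + δ n * C := fun n x hx => by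
    have hsub : volume.restrict (Ioo 0 x) ≤ μ :=
      Measure.restrict_mono (Ioo_subset_Ioo_right hx.2.le) le_rfl
    calc ∫⁻ s in Ioo 0 x, f s
        ≤ ∫⁻ s in Ioo 0 x, (ENNReal.ofReal (ψ n s) + ‖(F - ψ n) s‖ₑ) := by
          refine lintegral_mono_ae ?_
          filter_upwards [hFf.filter_mono (ae_mono hsub)] with s hs
          rw [← hs, ← Real.enorm_eq_ofReal (hψpos n s).le]
          simpa using enorm_add_le (ψ n s) (F s - ψ n s)
      _ = (∫⁻ s in Ioo 0 x, ENNReal.ofReal (ψ n s)) + ∫⁻ s in Ioo 0 x, ‖(F - ψ n) s‖ₑ :=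
          lintegral_add_left (hψc n).measurable.ennreal_ofReal _
      _ ≤ _ := by
          gcongr
          calc ∫⁻ s in Ioo 0 x, ‖(F - ψ n) s‖ₑ ≤ ∫⁻ s, ‖(F - ψ n) s‖ₑ ∂μ :=
                lintegral_mono' hsub le_rfl
            _ = eLpNorm (F - ψ n) 1 μ := eLpNorm_one_eq_lintegral_enorm.symm
            _ ≤ eLpNorm (F - ψ n) P μ * C := by
                simpa [hPt, hC] using
                  eLpNorm_le_eLpNorm_mul_rpow_measure_univ hP1 (hFmem.1.sub (hψm n))
            _ ≤ δ n * C := by gcongr; exact hψ n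
  have hbound : ∀ n, ∫⁻ x, ((∫⁻ s in Ioo 0 x, f s) - δ n * C) ^ q * w x ∂μ ≤
      K * (eLpNorm F P μ + δ n) ^ (p * c) := fun n => by
    calc ∫⁻ x, ((∫⁻ s in Ioo 0 x, f s) - δ n * C) ^ q * w x ∂μ
        ≤ ∫⁻ x, (∫⁻ s in Ioo 0 x, ENNReal.ofReal (ψ n s)) ^ q * w x ∂μ := by
          refine setLIntegral_mono' measurableSet_Ioo fun x hx => ?_
          gcongr
          exact tsub_le_iff_right.2 (hprim n x hx)
      _ ≤ K * (∫⁻ x, ENNReal.ofReal (ψ n x) ^ p ∂μ) ^ c := h _ (hψc n) (hψpos n)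
      _ = K * eLpNorm (ψ n) P μ ^ (p * c) := by
          rw [hnorm, ← ENNReal.rpow_mul]
          simp_rw [Real.enorm_eq_ofReal (hψpos n _).le]
          congr 2
          field_simp
      _ ≤ _ := by
          gcongr
          calc eLpNorm (ψ n) P μ = eLpNorm (F - (F - ψ n)) P μ := by rw [sub_sub_cancel]
            _ ≤ eLpNorm F P μ + eLpNorm (F - ψ n) P μ :=
                eLpNorm_sub_le hFmem.1 (hFmem.1.sub (hψm n)) hP1
            _ ≤ _ := by gcongr; exact hψ n
  have hmono : Monotone fun x => ∫⁻ s in Ioo 0 x, f s := fun x y hxy =>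
    lintegral_mono_set (Ioo_subset_Ioo_right hxy)
  have hδC : Tendsto (fun n => δ n * C) atTop (𝓝 0) := by
    simpa using ENNReal.Tendsto.mul_const hδlim (Or.inr hCfin)
  have hlim : ∀ x, Tendsto (fun n => ((∫⁻ s in Ioo 0 x, f s) - δ n * C) ^ q * w x) atTop
      (𝓝 ((∫⁻ s in Ioo 0 x, f s) ^ q * w x)) := fun x => by
    refine ENNReal.Tendsto.mul_const ?_ (Or.inr (hw' x))
    have := ENNReal.Tendsto.sub (tendsto_const_nhds (x := ∫⁻ s in Ioo 0 x, f s)) hδC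
      (Or.inr ENNReal.zero_ne_top)
    rw [tsub_zero] at this
    exact this.ennrpow_const q
  have hlimK : Tendsto (fun n => K * (eLpNorm F P μ + δ n) ^ (p * c)) atTop
      (𝓝 (K * eLpNorm F P μ ^ (p * c))) := by
    refine ENNReal.Tendsto.const_mul ?_ (Or.inr hK)
    simpa using (hδlim.const_add (eLpNorm F P μ)).ennrpow_const (p * c)
  calc ∫⁻ x, (∫⁻ s in Ioo 0 x, f s) ^ q * w x ∂μ
      = ∫⁻ x, liminf (fun n => ((∫⁻ s in Ioo 0 x, f s) - δ n * C) ^ q * w x) atTop ∂μ := by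
        simp_rw [(hlim _).liminf_eq]
    _ ≤ liminf (fun n => ∫⁻ x, ((∫⁻ s in Ioo 0 x, f s) - δ n * C) ^ q * w x ∂μ) atTop :=
        lintegral_liminf_le fun n => ((hmono.measurable.sub_const _).pow_const q).mul hw
    _ ≤ liminf (fun n => K * (eLpNorm F P μ + δ n) ^ (p * c)) atTop :=
        liminf_le_liminf (Eventually.of_forall hbound)
    _ = K * (∫⁻ x, f x ^ p ∂μ) ^ c := by
        rw [hlimK.liminf_eq, hN, ← ENNReal.rpow_mul]
        congr 2
        field_simp

theorem lintegral_Ioo_ofReal {φ : ℝ → ℝ} {x : ℝ} (hx : 0 ≤ x)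
    (hφ : IntervalIntegrable φ volume 0 x) (h0 : ∀ s ∈ Ioo 0 x, 0 ≤ φ s) :
    ∫⁻ s in Ioo 0 x, ENNReal.ofReal (φ s) = ENNReal.ofReal (∫ s in (0:ℝ)..x, φ s) := by
  rw [integral_of_le hx, integral_Ioc_eq_integral_Ioo, ofReal_integral_eq_lintegral_ofReal]
  · exact ((intervalIntegrable_iff_integrableOn_Ioo_of_le hx).1 hφ)
  · exact (ae_restrict_iff' measurableSet_Ioo).2 (Eventually.of_forall h0)

/-- The sharp constant in the weighted Hardy inequality of Bliss. -/
noncomputable def blissConst (p q r : ℝ) : ℝ :=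
  (q * ((p - 1) / p))⁻¹ * (1 / r * betaFn (1 / r) ((q - 1) / r)) ^ (-r)

theorem blissConst_pos {p r q : ℝ} (hp : 1 < p) (hr : 0 < r) (hq : q = p * (1 + r)) :
    0 < blissConst p q r := by
  have hq1 : 1 < q := by nlinarith
  have hp1 : 0 < p - 1 := sub_pos.2 hp
  have hB : 0 < betaFn (1 / r) ((q - 1) / r) :=
    betaFn_pos (by positivity) (div_pos (sub_pos.2 hq1) hr)
  have : 0 < q := by positivity
  unfold blissConst
  positivity

theorem lintegral_bliss_continuous {p r q : ℝ} (hp : 1 < p) (hr : 0 < r) (hq : q = p * (1 + r))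
    {φ : ℝ → ℝ} (hφ : Continuous φ) (hpos : ∀ x, 0 < φ x) (X : ℝ) :
    ∫⁻ x in Ioo 0 X, (∫⁻ s in Ioo 0 x, ENNReal.ofReal (φ s)) ^ q * ENNReal.ofReal (x ^ (r - q)) ≤
      ENNReal.ofReal (blissConst p q r) *
        (∫⁻ x in Ioo 0 X, ENNReal.ofReal (φ x) ^ p) ^ (1 + r) := by
  rcases le_or_gt X 0 with hX | hX
  · simp [Ioo_eq_empty hX.not_gt]
  have hp0 : 0 < p := by positivity
  have hq0 : 0 < q := by rw [hq]; positivity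
  obtain ⟨hint, hle⟩ := bliss_continuous hp hr hq hφ hpos hX
  have hF : ∀ x ∈ Ioo 0 X, 0 ≤ ∫ s in (0:ℝ)..x, φ s := fun x hx =>
    integral_nonneg hx.1.le fun s _ => (hpos s).le
  have hpow : IntervalIntegrable (fun x => φ x ^ p) volume 0 X :=
    (hφ.rpow_const fun x => Or.inr hp0.le).intervalIntegrable 0 X
  have hL : ∫⁻ x in Ioo 0 X, (∫⁻ s in Ioo 0 x, ENNReal.ofReal (φ s)) ^ q *
      ENNReal.ofReal (x ^ (r - q)) =
      ENNReal.ofReal (∫ x in (0:ℝ)..X, (∫ s in (0:ℝ)..x, φ s) ^ q * x ^ (r - q)) := by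
    rw [← lintegral_Ioo_ofReal hX.le hint fun x hx =>
      mul_nonneg (Real.rpow_nonneg (hF x hx) _) (Real.rpow_nonneg hx.1.le _)]
    refine setLIntegral_congr_fun measurableSet_Ioo fun x hx => ?_
    rw [lintegral_Ioo_ofReal hx.1.le (hφ.intervalIntegrable 0 x) fun s _ => (hpos s).le,
      ENNReal.ofReal_rpow_of_nonneg (hF x hx) hq0.le,
      ENNReal.ofReal_mul (Real.rpow_nonneg (hF x hx) _)]
  have hR : ∫⁻ x in Ioo 0 X, ENNReal.ofReal (φ x) ^ p =
      ENNReal.ofReal (∫ x in (0:ℝ)..X, φ x ^ p) := by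
    rw [← lintegral_Ioo_ofReal hX.le hpow fun x _ => Real.rpow_nonneg (hpos x).le _]
    simp_rw [ENNReal.ofReal_rpow_of_nonneg (hpos _).le hp0.le]
  have hR0 : 0 ≤ ∫ x in (0:ℝ)..X, φ x ^ p :=
    integral_nonneg hX.le fun x _ => Real.rpow_nonneg (hpos x).le _
  rw [hL, hR, ENNReal.ofReal_rpow_of_nonneg hR0 (by positivity),
    ← ENNReal.ofReal_mul (blissConst_pos hp hr hq).le]
  exact ENNReal.ofReal_le_ofReal hle

/-- The inequality of Bliss on the half-line for measurable functions. -/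
theorem lintegral_bliss {p r q : ℝ} (hp : 1 < p) (hr : 0 < r) (hq : q = p * (1 + r))
    {f : ℝ → ℝ≥0∞} (hf : Measurable f) :
    ∫⁻ x in Ioi 0, (∫⁻ s in Ioo 0 x, f s) ^ q * ENNReal.ofReal (x ^ (r - q)) ≤
      ENNReal.ofReal (blissConst p q r) * (∫⁻ x in Ioi 0, f x ^ p) ^ (1 + r) := by
  have hunion : Ioi (0 : ℝ) = ⋃ n : ℕ, Ioo (0 : ℝ) n := by
    ext x
    simpa using fun _ => exists_nat_gt x
  have hdir : Directed (· ⊆ ·) fun n : ℕ => Ioo (0 : ℝ) n :=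
    Monotone.directed_le fun m n hmn => Ioo_subset_Ioo_right (by exact_mod_cast hmn)
  conv_lhs => rw [hunion, setLIntegral_iUnion_of_directed _ hdir]
  refine iSup_le fun n => ?_
  refine (lintegral_hardy_of_continuous hp (by rw [hq]; positivity) (by positivity)
    (measurable_id.pow_const (r - q)).ennreal_ofReal (fun _ => ENNReal.ofReal_ne_top)
    (by simpa using blissConst_pos hp hr hq) ENNReal.ofReal_ne_top
    (fun φ hφ hpos => lintegral_bliss_continuous hp hr hq hφ hpos n) hf).trans ?_
  gcongr
  exact Ioo_subset_Ioi_self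

theorem image_rpow_Ioi {ν : ℝ} (hν : 0 < ν) : (fun x : ℝ => x ^ ν) '' Ioi 0 = Ioi 0 := by
  refine Subset.antisymm (image_subset_iff.2 fun x hx => Real.rpow_pos_of_pos hx ν) fun y hy => ?_
  exact ⟨y ^ ν⁻¹, Real.rpow_pos_of_pos hy _, Real.rpow_inv_rpow (le_of_lt hy) hν.ne'⟩

theorem image_rpow_Ioo {ν s : ℝ} (hν : 0 < ν) (hs : 0 < s) :
    (fun x : ℝ => x ^ ν) '' Ioo 0 s = Ioo 0 (s ^ ν) := by
  refine Subset.antisymm (image_subset_iff.2 fun x hx =>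
    ⟨Real.rpow_pos_of_pos hx.1 ν, Real.rpow_lt_rpow hx.1.le hx.2 hν⟩) fun y hy => ?_
  refine ⟨y ^ ν⁻¹, ⟨Real.rpow_pos_of_pos hy.1 _, ?_⟩, Real.rpow_inv_rpow hy.1.le hν.ne'⟩
  exact (Real.rpow_inv_lt_iff_of_pos hy.1.le hs.le hν).2 hy.2

theorem lintegral_image_rpow {ν : ℝ} (hν : 0 < ν) {S : Set ℝ} (hS : MeasurableSet S)
    (hS0 : S ⊆ Ioi 0) (G : ℝ → ℝ≥0∞) :
    ∫⁻ x in (fun x : ℝ => x ^ ν) '' S, G x =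
      ∫⁻ x in S, ENNReal.ofReal (ν * x ^ (ν - 1)) * G (x ^ ν) := by
  rw [lintegral_image_eq_lintegral_abs_deriv_mul hS
    (fun x hx => (Real.hasDerivAt_rpow_const (Or.inl (hS0 hx).ne')).hasDerivWithinAt)
    fun x hx y hy h => (Real.rpow_left_inj (le_of_lt (hS0 hx)) (le_of_lt (hS0 hy)) hν.ne').1 h]
  refine setLIntegral_congr_fun hS fun x hx => ?_
  have : 0 ≤ ν * x ^ (ν - 1) := mul_nonneg hν.le (Real.rpow_nonneg (le_of_lt (hS0 hx)) _)
  simp only [abs_of_nonneg this]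

theorem lintegral_bliss_rpow {p r q ν : ℝ} (hp : 1 < p) (hr : 0 < r) (hq : q = p * (1 + r))
    (hν : 0 < ν) {f : ℝ → ℝ≥0∞} (hf : Measurable f) :
    ∫⁻ s in Ioi 0, ENNReal.ofReal (ν * s ^ (-ν * q * (1 - 1 / p) - 1)) *
        (∫⁻ t in Ioo 0 s, ENNReal.ofReal (ν * t ^ (ν - 1)) * f t) ^ q ≤
      ENNReal.ofReal (blissConst p q r) *
        (∫⁻ s in Ioi 0, ENNReal.ofReal (ν * s ^ (ν - 1)) * f s ^ p) ^ (1 + r) := by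
  have hp0 : 0 < p := by positivity
  have hroot : ∀ t ∈ Ioi (0 : ℝ), f ((t ^ ν) ^ ν⁻¹) = f t := fun t ht => by
    rw [Real.rpow_rpow_inv (le_of_lt ht) hν.ne']
  have key := lintegral_bliss hp hr hq (hf.comp (measurable_id.pow_const ν⁻¹))
  simp only [Function.comp_apply, id] at key
  nth_rewrite 1 2 [← image_rpow_Ioi hν] at key
  rw [lintegral_image_rpow hν measurableSet_Ioi subset_rfl,
    lintegral_image_rpow hν measurableSet_Ioi subset_rfl] at key
  convert! key using 1
  · refine setLIntegral_congr_fun measurableSet_Ioi fun s hs => ?_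
    have hs0 : 0 < s := hs
    have hexp : ν * s ^ (-ν * q * (1 - 1 / p) - 1) = ν * s ^ (ν - 1) * (s ^ ν) ^ (r - q) := by
      rw [← Real.rpow_mul hs0.le, mul_assoc ν, ← Real.rpow_add hs0, hq]
      congr 2
      field_simp
      ring
    have hin : ∫⁻ t in Ioo 0 s, ENNReal.ofReal (ν * t ^ (ν - 1)) * f t =
        ∫⁻ t in Ioo 0 (s ^ ν), f (t ^ ν⁻¹) := by
      rw [← image_rpow_Ioo hν hs0, lintegral_image_rpow hν measurableSet_Ioo Ioo_subset_Ioi_self]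
      exact setLIntegral_congr_fun measurableSet_Ioo fun t ht => by simp only [hroot t ht.1]
    rw [hin, hexp, ENNReal.ofReal_mul (by positivity)]
    ring
  · congr 2
    exact setLIntegral_congr_fun measurableSet_Ioi fun s hs => by simp only [hroot s hs]

/-- The Minkowski integral inequality. -/
theorem lintegral_rpow_lintegral_le {α β : Type*} [MeasurableSpace α] [MeasurableSpace β]
    {μ : Measure α} {ν : Measure β} [SFinite μ] [SigmaFinite ν] {ρ : ℝ} (hρ : 1 < ρ)
    {f : α × β → ℝ≥0∞} (hf : Measurable f) :
    ∫⁻ b, (∫⁻ a, f (a, b) ∂μ) ^ ρ ∂ν ≤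
      (∫⁻ a, (∫⁻ b, f (a, b) ^ ρ ∂ν) ^ (1 / ρ) ∂μ) ^ ρ := by
  have hρ0 : 0 < ρ := by positivity
  have hρ1 : 0 < ρ - 1 := sub_pos.2 hρ
  set H : β → ℝ≥0∞ := fun b => ∫⁻ a, f (a, b) ∂μ with hH
  set R := ∫⁻ a, (∫⁻ b, f (a, b) ^ ρ ∂ν) ^ (1 / ρ) ∂μ with hR
  refine le_of_forall_lt fun L hL => ?_
  rw [lintegral_eq_nnreal] at hL
  simp_rw [lt_iSup_iff] at hL
  obtain ⟨g₀, hg₀, hL⟩ := hL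
  rw [← SimpleFunc.lintegral_eq_lintegral] at hL
  obtain ⟨g, hg, hgfin, hLg⟩ := SimpleFunc.exists_lt_lintegral_simpleFunc_of_lt_lintegral hL
  refine hLg.trans_le ?_
  set A := ∫⁻ b, (g b : ℝ≥0∞) ∂ν with hA
  set h : β → ℝ≥0∞ := fun b => (g b : ℝ≥0∞) ^ (1 / ρ) with hh
  have hgm : Measurable fun b => (g b : ℝ≥0∞) := g.measurable.coe_nnreal_ennreal
  have hhm : Measurable h := hgm.pow_const _
  have hhH : ∀ b, h b ≤ H b := fun b => by
    have : (g b : ℝ≥0∞) ≤ H b ^ ρ := (ENNReal.coe_le_coe.2 (hg b)).trans (hg₀ b)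
    calc h b ≤ (H b ^ ρ) ^ (1 / ρ) := ENNReal.rpow_le_rpow this (by positivity)
      _ = H b := by rw [← ENNReal.rpow_mul, mul_one_div_cancel hρ0.ne', ENNReal.rpow_one]
  rcases eq_or_ne A 0 with hA0 | hA0
  · simp [hA0]
  have hconj : ρ.HolderConjugate (ρ / (ρ - 1)) := Real.HolderConjugate.conjExponent hρ
  have key : A ≤ R * A ^ (1 - 1 / ρ) := by
    calc A = ∫⁻ b, h b * h b ^ (ρ - 1) ∂ν := by
          refine lintegral_congr fun b => ?_
          simp only [hh]
          rw [← ENNReal.rpow_mul, ← ENNReal.rpow_add_of_nonneg _ _ (by positivity) (by positivity)]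
          rw [show 1 / ρ + 1 / ρ * (ρ - 1) = 1 by field_simp; ring, ENNReal.rpow_one]
      _ ≤ ∫⁻ b, H b * h b ^ (ρ - 1) ∂ν := by gcongr with b; exact hhH b
      _ = ∫⁻ b, ∫⁻ a, f (a, b) * h b ^ (ρ - 1) ∂μ ∂ν := by
          refine lintegral_congr fun b => ?_
          exact (lintegral_mul_const _ (hf.comp measurable_prodMk_right)).symm
      _ = ∫⁻ a, ∫⁻ b, f (a, b) * h b ^ (ρ - 1) ∂ν ∂μ := by
          refine lintegral_lintegral_swap (Measurable.aemeasurable ?_)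
          exact (hf.comp measurable_swap).mul ((hhm.comp measurable_fst).pow_const _)
      _ ≤ ∫⁻ a, (∫⁻ b, f (a, b) ^ ρ ∂ν) ^ (1 / ρ) * A ^ (1 - 1 / ρ) ∂μ := by
          gcongr with a
          refine (ENNReal.lintegral_mul_le_Lp_mul_Lq ν hconj
            (hf.comp measurable_prodMk_left).aemeasurable
            (hhm.pow_const _).aemeasurable).trans_eq ?_
          congr 2
          · refine lintegral_congr fun b => ?_
            simp only [hh]
            rw [← ENNReal.rpow_mul, ← ENNReal.rpow_mul]
            rw [show 1 / ρ * ((ρ - 1) * (ρ / (ρ - 1))) = 1 by field_simp, ENNReal.rpow_one]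
          · field_simp
      _ = R * A ^ (1 - 1 / ρ) := by
          refine lintegral_mul_const _ (Measurable.pow_const ?_ _)
          exact (hf.pow_const ρ).lintegral_prod_right'
  have hAR : A ^ (1 / ρ) ≤ R := by
    have hB0 : A ^ (1 - 1 / ρ) ≠ 0 := by simp [hA0, hgfin.ne]
    have hBt : A ^ (1 - 1 / ρ) ≠ ∞ := by simp [hA0, hgfin.ne]
    rw [← ENNReal.mul_le_mul_iff_left hB0 hBt, ← ENNReal.rpow_add _ _ hA0 hgfin.ne]
    simpa using key
  calc A = (A ^ (1 / ρ)) ^ ρ := by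
        rw [← ENNReal.rpow_mul, one_div_mul_cancel hρ0.ne', ENNReal.rpow_one]
    _ ≤ R ^ ρ := by gcongr

theorem measurable_setLIntegral_Iio {μ : Measure ℝ} [SFinite μ] {h : ℝ × ℝ → ℝ≥0∞}
    (hh : Measurable h) : Measurable fun z : ℝ × ℝ => ∫⁻ r in Iio z.2, h (z.1, r) ∂μ := by
  have hset : MeasurableSet {x : (ℝ × ℝ) × ℝ | x.2 < x.1.2} :=
    measurableSet_lt measurable_snd measurable_fst.snd
  have hm : Measurable ({x : (ℝ × ℝ) × ℝ | x.2 < x.1.2}.indicator fun x => h (x.1.1, x.2)) :=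
    (hh.comp (measurable_fst.fst.prodMk measurable_snd)).indicator hset
  convert! hm.lintegral_prod_right' (ν := μ) using 2 with z
  rw [← lintegral_indicator measurableSet_Iio]
  rfl

/-- Two one-dimensional Hardy inequalities tensorize, by the Minkowski integral inequality. -/
theorem twofold_hardy_of_hardy {p q : ℝ} (hp : 0 < p) (hpq : p < q) {μ₁ μ₂ ν₁ ν₂ : Measure ℝ}
    [SFinite μ₁] [SFinite μ₂] [SFinite ν₁] [SigmaFinite ν₂] {K₁ K₂ : ℝ≥0∞}
    (h₁ : ∀ f : ℝ → ℝ≥0∞, Measurable f →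
      ∫⁻ s, (∫⁻ r in Iio s, f r ∂μ₁) ^ q ∂ν₁ ≤ K₁ * (∫⁻ s, f s ^ p ∂μ₁) ^ (q / p))
    (h₂ : ∀ f : ℝ → ℝ≥0∞, Measurable f →
      ∫⁻ s, (∫⁻ r in Iio s, f r ∂μ₂) ^ q ∂ν₂ ≤ K₂ * (∫⁻ s, f s ^ p ∂μ₂) ^ (q / p))
    {g : ℝ × ℝ → ℝ≥0∞} (hg : Measurable g) :
    ∫⁻ s₁, ∫⁻ s₂, (∫⁻ r₁ in Iio s₁, ∫⁻ r₂ in Iio s₂, g (r₁, r₂) ∂μ₂ ∂μ₁) ^ q ∂ν₂ ∂ν₁ ≤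
      K₁ * K₂ * (∫⁻ s₁, ∫⁻ s₂, g (s₁, s₂) ^ p ∂μ₂ ∂μ₁) ^ (q / p) := by
  have hρ : 1 < q / p := (one_lt_div hp).2 hpq
  have hρ0 : 0 < q / p := one_pos.trans hρ
  set G : ℝ × ℝ → ℝ≥0∞ := fun z => ∫⁻ r₂ in Iio z.2, g (z.1, r₂) ∂μ₂ with hG
  have hGm : Measurable G := measurable_setLIntegral_Iio hg
  have hΦm : Measurable fun z : ℝ × ℝ => ∫⁻ r₁ in Iio z.2, G (r₁, z.1) ∂μ₁ :=
    measurable_setLIntegral_Iio (hGm.comp measurable_swap)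
  calc ∫⁻ s₁, ∫⁻ s₂, (∫⁻ r₁ in Iio s₁, G (r₁, s₂) ∂μ₁) ^ q ∂ν₂ ∂ν₁
      = ∫⁻ s₂, ∫⁻ s₁, (∫⁻ r₁ in Iio s₁, G (r₁, s₂) ∂μ₁) ^ q ∂ν₁ ∂ν₂ :=
        lintegral_lintegral_swap ((hΦm.comp measurable_swap).pow_const q).aemeasurable
    _ ≤ ∫⁻ s₂, K₁ * (∫⁻ r₁, G (r₁, s₂) ^ p ∂μ₁) ^ (q / p) ∂ν₂ :=
        lintegral_mono fun s₂ => h₁ _ (hGm.comp measurable_prodMk_right)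
    _ = K₁ * ∫⁻ s₂, (∫⁻ r₁, G (r₁, s₂) ^ p ∂μ₁) ^ (q / p) ∂ν₂ :=
        lintegral_const_mul _ ((hGm.pow_const p).lintegral_prod_left'.pow_const _)
    _ ≤ K₁ * (∫⁻ r₁, (∫⁻ s₂, (G (r₁, s₂) ^ p) ^ (q / p) ∂ν₂) ^ (1 / (q / p)) ∂μ₁) ^ (q / p) := by
        gcongr
        exact lintegral_rpow_lintegral_le hρ (hGm.pow_const p)
    _ ≤ K₁ * (∫⁻ r₁, K₂ ^ (1 / (q / p)) * ∫⁻ r₂, g (r₁, r₂) ^ p ∂μ₂ ∂μ₁) ^ (q / p) := by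
        gcongr with r₁
        have := h₂ _ (hg.comp (measurable_prodMk_left (x := r₁)))
        calc (∫⁻ s₂, (G (r₁, s₂) ^ p) ^ (q / p) ∂ν₂) ^ (1 / (q / p))
            = (∫⁻ s₂, G (r₁, s₂) ^ q ∂ν₂) ^ (1 / (q / p)) := by
              simp_rw [← ENNReal.rpow_mul, mul_div_cancel₀ q hp.ne']
          _ ≤ (K₂ * (∫⁻ r₂, g (r₁, r₂) ^ p ∂μ₂) ^ (q / p)) ^ (1 / (q / p)) := by
              gcongr
              exact this
          _ = K₂ ^ (1 / (q / p)) * ∫⁻ r₂, g (r₁, r₂) ^ p ∂μ₂ := by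
              rw [ENNReal.mul_rpow_of_nonneg _ _ (by positivity), ← ENNReal.rpow_mul,
                mul_one_div_cancel hρ0.ne', ENNReal.rpow_one]
    _ = K₁ * K₂ * (∫⁻ s₁, ∫⁻ s₂, g (s₁, s₂) ^ p ∂μ₂ ∂μ₁) ^ (q / p) := by
        rw [lintegral_const_mul _ (hg.pow_const p).lintegral_prod_right',
          ENNReal.mul_rpow_of_nonneg _ _ hρ0.le, ← ENNReal.rpow_mul,
          one_div_mul_cancel hρ0.ne', ENNReal.rpow_one, mul_assoc]

/-- The measure `c x ^ e dx` on the half-line `x > 0`. -/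
noncomputable def powerMeasure (c e : ℝ) : Measure ℝ :=
  (volume.restrict (Ioi 0)).withDensity fun x => ENNReal.ofReal (c * x ^ e)

instance (c e : ℝ) : SigmaFinite (powerMeasure c e) :=
  SigmaFinite.withDensity_ofReal _

theorem setLIntegral_powerMeasure (c e : ℝ) {S : Set ℝ} (hS : MeasurableSet S) (f : ℝ → ℝ≥0∞) :
    ∫⁻ x in S, f x ∂powerMeasure c e =
      ∫⁻ x in S ∩ Ioi 0, ENNReal.ofReal (c * x ^ e) * f x := by
  rw [powerMeasure, setLIntegral_withDensity_eq_setLIntegral_mul_non_measurable _ (by fun_prop) _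
    hS (Eventually.of_forall fun _ => ENNReal.ofReal_lt_top), Measure.restrict_restrict hS]
  rfl

theorem lintegral_powerMeasure (c e : ℝ) (f : ℝ → ℝ≥0∞) :
    ∫⁻ x, f x ∂powerMeasure c e = ∫⁻ x in Ioi 0, ENNReal.ofReal (c * x ^ e) * f x := by
  simpa using setLIntegral_powerMeasure c e .univ f

theorem setLIntegral_Iio_powerMeasure (c e s : ℝ) (f : ℝ → ℝ≥0∞) :
    ∫⁻ x in Iio s, f x ∂powerMeasure c e =
      ∫⁻ x in Ioo 0 s, ENNReal.ofReal (c * x ^ e) * f x := by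
  rw [setLIntegral_powerMeasure c e measurableSet_Iio, inter_comm, Ioi_inter_Iio]

theorem natCast_mul_lintegral_lintegral_rpow (m n : ℕ) (a b : ℝ) {S T : Set ℝ}
    (hS : MeasurableSet S) (hS0 : S ⊆ Ioi 0) (F : ℝ → ℝ → ℝ≥0∞) :
    (m : ℝ≥0∞) * (n : ℝ≥0∞) *
        ∫⁻ x in S, ∫⁻ y in T, F x y * ENNReal.ofReal (x ^ a * y ^ b) =
      ∫⁻ x in S, ENNReal.ofReal (m * x ^ a) *
        ∫⁻ y in T, ENNReal.ofReal (n * y ^ b) * F x y := by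
  rw [← lintegral_const_mul' _ _ (by finiteness)]
  refine setLIntegral_congr_fun hS fun x hx => ?_
  have hx0 : 0 ≤ x ^ a := Real.rpow_nonneg (le_of_lt (hS0 hx)) _
  rw [← lintegral_const_mul' _ _ (by finiteness), ← lintegral_const_mul' _ _ (by finiteness)]
  refine lintegral_congr fun y => ?_
  rw [ENNReal.ofReal_mul hx0, ENNReal.ofReal_mul (Nat.cast_nonneg m),
    ENNReal.ofReal_mul (Nat.cast_nonneg n), ENNReal.ofReal_natCast, ENNReal.ofReal_natCast]
  ring

theorem lintegral_powerMeasure_hardy {p q : ℝ} (hp : 1 < p) (hpq : p < q) {n : ℕ} (hn : 1 ≤ n)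
    {f : ℝ → ℝ≥0∞} (hf : Measurable f) :
    ∫⁻ s, (∫⁻ t in Iio s, f t ∂powerMeasure n (n - 1)) ^ q
        ∂powerMeasure n (-n * q * (1 - 1 / p) - 1) ≤
      ENNReal.ofReal (blissConst p q (q / p - 1)) *
        (∫⁻ s, f s ^ p ∂powerMeasure n (n - 1)) ^ (q / p) := by
  have hp0 : 0 < p := by positivity
  have hr : 0 < q / p - 1 := sub_pos.2 ((one_lt_div hp0).2 hpq)
  have hq : q = p * (1 + (q / p - 1)) := by field_simp; ring
  have := lintegral_bliss_rpow hp hr hq (Nat.cast_pos.2 hn) hf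
  rw [add_sub_cancel] at this
  simpa only [lintegral_powerMeasure, setLIntegral_Iio_powerMeasure] using this

theorem ofReal_sq_rpow_eq_blissConst {p q : ℝ} (hp : 1 < p) (hpq : p < q) :
    (ENNReal.ofReal
      ((((p / (p - 1)) / q) ^ (1 / q) *
        ((p / (q - p)) *
          betaFn (p / (q - p)) (p * q / ((q / (q - 1)) * (q - p)))) ^ (1 / q - 1 / p)) ^ 2)) ^ q =
      ENNReal.ofReal (blissConst p q (q / p - 1)) *
        ENNReal.ofReal (blissConst p q (q / p - 1)) := by
  have hp0 : 0 < p := by positivity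
  have hq0 : 0 < q := hp0.trans hpq
  have hp1 : 0 < p - 1 := sub_pos.2 hp
  have hq1 : 0 < q - 1 := sub_pos.2 (hp.trans hpq)
  have hqp : 0 < q - p := sub_pos.2 hpq
  have hr : 0 < q / p - 1 := sub_pos.2 ((one_lt_div hp0).2 hpq)
  have hz : 1 / (q / p - 1) = p / (q - p) := by field_simp
  have hw : (q - 1) / (q / p - 1) = p * q / ((q / (q - 1)) * (q - p)) := by field_simp
  set B := betaFn (p / (q - p)) (p * q / ((q / (q - 1)) * (q - p))) with hB
  have hB0 : 0 < B := betaFn_pos (by positivity) (by positivity)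
  set a := p / (p - 1) / q with ha
  set b := p / (q - p) * B with hb
  have ha0 : 0 < a := by positivity
  have hb0 : 0 < b := by positivity
  have hK : blissConst p q (q / p - 1) = (a ^ (1 / q) * b ^ (1 / q - 1 / p)) ^ q := by
    rw [blissConst, hz, hw, ← hB, ← hb,
      Real.mul_rpow (x := a ^ (1 / q)) (by positivity) (by positivity),
      ← Real.rpow_mul ha0.le, ← Real.rpow_mul hb0.le, one_div_mul_cancel hq0.ne', Real.rpow_one]
    congr 1
    · rw [ha]; field_simp
    · congr 1; field_simp; ring
  rw [hK, ENNReal.ofReal_rpow_of_nonneg (by positivity) hq0.le,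
    ← ENNReal.ofReal_mul (by positivity), ← Real.mul_rpow (by positivity) (by positivity), sq]

end

/-- Polar-coordinate form of the two-fold fractional Hardy inequality with
`β_i = n_i (1/p - 1/q)`. -/
theorem polar_twofold_hardy (n₁ n₂ : ℕ) (hn₁ : 1 ≤ n₁) (hn₂ : 1 ≤ n₂) (p q : ℝ)
    (hp : 1 < p) (hpq : p < q) (g : ℝ × ℝ → ℝ≥0∞) (hg : Measurable g) :
    (n₁ : ℝ≥0∞) * (n₂ : ℝ≥0∞) *
      ∫⁻ s₁ in Ioi (0 : ℝ), ∫⁻ s₂ in Ioi (0 : ℝ),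
        ((n₁ : ℝ≥0∞) * (n₂ : ℝ≥0∞) *
            ∫⁻ r₁ in Ioo (0 : ℝ) s₁, ∫⁻ r₂ in Ioo (0 : ℝ) s₂,
              g (r₁, r₂) * ENNReal.ofReal (r₁ ^ ((n₁ : ℝ) - 1) * r₂ ^ ((n₂ : ℝ) - 1))) ^ q *
          ENNReal.ofReal (s₁ ^ (-(n₁ : ℝ) * q * (1 - 1 / p) - 1) *
            s₂ ^ (-(n₂ : ℝ) * q * (1 - 1 / p) - 1))
      ≤ (ENNReal.ofReal
            ((((p / (p - 1)) / q) ^ (1 / q) *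
                ((p / (q - p)) *
                  betaFn (p / (q - p)) (p * q / ((q / (q - 1)) * (q - p)))) ^ (1 / q - 1 / p)) ^ 2)) ^ q *
        ((n₁ : ℝ≥0∞) * (n₂ : ℝ≥0∞) *
          ∫⁻ s₁ in Ioi (0 : ℝ), ∫⁻ s₂ in Ioi (0 : ℝ),
            g (s₁, s₂) ^ p *
              ENNReal.ofReal (s₁ ^ ((n₁ : ℝ) - 1) * s₂ ^ ((n₂ : ℝ) - 1))) ^ (q / p) := by
  rw [natCast_mul_lintegral_lintegral_rpow n₁ n₂ _ _ measurableSet_Ioi subset_rfl,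
    natCast_mul_lintegral_lintegral_rpow n₁ n₂ _ _ measurableSet_Ioi subset_rfl,
    ofReal_sq_rpow_eq_blissConst hp hpq]
  have key := twofold_hardy_of_hardy (by positivity) hpq
    (fun f hf => lintegral_powerMeasure_hardy hp hpq hn₁ (f := f) hf)
    (fun f hf => lintegral_powerMeasure_hardy hp hpq hn₂ (f := f) hf) hg
  simp only [lintegral_powerMeasure, setLIntegral_Iio_powerMeasure] at key
  refine (setLIntegral_congr_fun measurableSet_Ioi fun s₁ _ => ?_).trans_le key
  congr 1
  refine setLIntegral_congr_fun measurableSet_Ioi fun s₂ _ => ?_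
  rw [natCast_mul_lintegral_lintegral_rpow n₁ n₂ _ _ measurableSet_Ioo Ioo_subset_Ioi_self]
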